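/- Suppose (x*, y*, λ*) is a solution of the variational inequality VI(F, θ, Ω), (x⁺, y⁺, λ⁺) is a linearized ADMM step from (y^k, λ^k) with parameters β, δ_k, where δ_k > 0 and the previous parameter δ_{k−1} satisfies δ_{k−1} ≥ 1. Let ε ∈ (0, 1/2) be such that D = δ_k·I_{n₂} − (1/(2ε))·BᵀB is positive definite, and set ξ = max{0, δ_k − δ_{k−1}}. Then δ_kβ·‖y⁺ − y*‖² + (1/β)·‖λ⁺ − λ*‖² ≤ (1 + ξ)·(δ_{k−1}β·‖y^k − y*‖² + (1/β)·‖λ^k − λ*‖²) − β·(y⁺ − y^k)ᵀD(y⁺ − y^k) − ((1 − 2ε)/β)·‖λ⁺ − λ^k‖². -/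

import Mathlib

open Matrix Filter

variable {m n₁ n₂ : ℕ}

/-- `(x*, y*, λ*)` is a solution of the variational inequality `VI(F, θ, Ω)`. -/
def VISolution (A : Matrix (Fin m) (Fin n₁) ℝ) (B : Matrix (Fin m) (Fin n₂) ℝ)
    (b : Fin m → ℝ) (X : Set (Fin n₁ → ℝ)) (Y : Set (Fin n₂ → ℝ))
    (θ₁ : (Fin n₁ → ℝ) → ℝ) (θ₂ : (Fin n₂ → ℝ) → ℝ)
    (xs : Fin n₁ → ℝ) (ys : Fin n₂ → ℝ) (ls : Fin m → ℝ) : Prop :=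
  xs ∈ X ∧ ys ∈ Y ∧
    (∀ x ∈ X, θ₁ x - θ₁ xs + (x - xs) ⬝ᵥ (-(Aᵀ *ᵥ ls)) ≥ 0) ∧
    (∀ y ∈ Y, θ₂ y - θ₂ ys + (y - ys) ⬝ᵥ (-(Bᵀ *ᵥ ls)) ≥ 0) ∧
    A *ᵥ xs + B *ᵥ ys = b

/-- `(x⁺, y⁺, λ⁺)` is a linearized ADMM step from `(yk, λk)` with parameters
`β, δ`. -/
def ADMMStep (A : Matrix (Fin m) (Fin n₁) ℝ) (B : Matrix (Fin m) (Fin n₂) ℝ)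
    (b : Fin m → ℝ) (X : Set (Fin n₁ → ℝ)) (Y : Set (Fin n₂ → ℝ))
    (θ₁ : (Fin n₁ → ℝ) → ℝ) (θ₂ : (Fin n₂ → ℝ) → ℝ) (β δ : ℝ)
    (yk : Fin n₂ → ℝ) (lk : Fin m → ℝ)
    (xp : Fin n₁ → ℝ) (yp : Fin n₂ → ℝ) (lp : Fin m → ℝ) : Prop :=
  xp ∈ X ∧ yp ∈ Y ∧
    (∀ x ∈ X, θ₁ x - θ₁ xp +
      (x - xp) ⬝ᵥ (-(Aᵀ *ᵥ lk) + β • (Aᵀ *ᵥ (A *ᵥ xp + B *ᵥ yk - b))) ≥ 0) ∧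
    (∀ y ∈ Y, θ₂ y - θ₂ yp +
      (y - yp) ⬝ᵥ (-(Bᵀ *ᵥ lk) + β • (Bᵀ *ᵥ (A *ᵥ xp + B *ᵥ yk - b))
        + (β * δ) • (yp - yk)) ≥ 0) ∧
    lp = lk - β • (A *ᵥ xp + B *ᵥ yp - b)

/-- Transposing a matrix across the dot product. -/
theorem dotProduct_transpose_mulVec_eq {p q : ℕ} (M : Matrix (Fin p) (Fin q) ℝ)
    (u : Fin q → ℝ) (v : Fin p → ℝ) : u ⬝ᵥ (Mᵀ *ᵥ v) = (M *ᵥ u) ⬝ᵥ v := by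
  rw [dotProduct_mulVec, vecMul_transpose]

/-- Weighted Young inequality for the dot product. -/
theorem two_mul_dotProduct_le {p : ℕ} (u v : Fin p → ℝ) {ε : ℝ} (hε : 0 < ε) :
    2 * (u ⬝ᵥ v) ≤ 2 * ε * (u ⬝ᵥ u) + 1 / (2 * ε) * (v ⬝ᵥ v) := by
  have h : 0 ≤ ((2 * ε) • u - v) ⬝ᵥ ((2 * ε) • u - v) := by
    simpa using dotProduct_star_self_nonneg ((2 * ε) • u - v)
  simp only [sub_dotProduct, dotProduct_sub, smul_dotProduct, dotProduct_smul, smul_eq_mul,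
    dotProduct_comm v u] at h
  rw [← sub_nonneg]
  have e : 2 * ε * (u ⬝ᵥ u) + 1 / (2 * ε) * (v ⬝ᵥ v) - 2 * (u ⬝ᵥ v) =
      (2 * ε * (2 * ε * (u ⬝ᵥ u)) - 2 * ε * (u ⬝ᵥ v) - (2 * ε * (u ⬝ᵥ v) - v ⬝ᵥ v)) /
        (2 * ε) := by
    field_simp
    ring
  rw [e]
  exact div_nonneg (by linarith) (by positivity)

/-- The cross-term inequality obtained by testing the step and the solution against each other. -/
theorem ADMMStep.cross_term_nonneg {A : Matrix (Fin m) (Fin n₁) ℝ}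
    {B : Matrix (Fin m) (Fin n₂) ℝ} {b : Fin m → ℝ} {X : Set (Fin n₁ → ℝ)}
    {Y : Set (Fin n₂ → ℝ)} {θ₁ : (Fin n₁ → ℝ) → ℝ} {θ₂ : (Fin n₂ → ℝ) → ℝ} {β δ : ℝ}
    {xs : Fin n₁ → ℝ} {ys : Fin n₂ → ℝ} {ls : Fin m → ℝ} {yk : Fin n₂ → ℝ} {lk : Fin m → ℝ}
    {xp : Fin n₁ → ℝ} {yp : Fin n₂ → ℝ} {lp : Fin m → ℝ}
    (hstep : ADMMStep A B b X Y θ₁ θ₂ β δ yk lk xp yp lp)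
    (hsol : VISolution A B b X Y θ₁ θ₂ xs ys ls) :
    0 ≤ (A *ᵥ xp + B *ᵥ yp - b) ⬝ᵥ (lp - ls) +
      β * ((A *ᵥ xp + B *ᵥ yp - b) ⬝ᵥ (B *ᵥ (yp - yk))) -
      β * δ * ((yp - ys) ⬝ᵥ (yp - yk)) := by
  obtain ⟨hxs, hys, hs₁, hs₂, hb⟩ := hsol
  obtain ⟨hxp, hyp, hp₁, hp₂, hl⟩ := hstep
  have h₁ := hs₁ xp hxp
  have h₂ := hs₂ yp hyp
  have h₃ := hp₁ xs hxs
  have h₄ := hp₂ ys hys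
  subst hl
  subst hb
  simp only [dotProduct_add, dotProduct_neg, dotProduct_smul, smul_eq_mul,
    dotProduct_transpose_mulVec_eq, mulVec_sub, sub_dotProduct, dotProduct_sub,
    add_dotProduct] at h₁ h₂ h₃ h₄ ⊢
  linarith

/-- The energy estimate with the current proximal parameter on both sides. -/
theorem ADMMStep.energy_le {A : Matrix (Fin m) (Fin n₁) ℝ}
    {B : Matrix (Fin m) (Fin n₂) ℝ} {b : Fin m → ℝ} {X : Set (Fin n₁ → ℝ)}
    {Y : Set (Fin n₂ → ℝ)} {θ₁ : (Fin n₁ → ℝ) → ℝ} {θ₂ : (Fin n₂ → ℝ) → ℝ} {β δ : ℝ}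
    {xs : Fin n₁ → ℝ} {ys : Fin n₂ → ℝ} {ls : Fin m → ℝ} {yk : Fin n₂ → ℝ} {lk : Fin m → ℝ}
    {xp : Fin n₁ → ℝ} {yp : Fin n₂ → ℝ} {lp : Fin m → ℝ}
    (hstep : ADMMStep A B b X Y θ₁ θ₂ β δ yk lk xp yp lp)
    (hsol : VISolution A B b X Y θ₁ θ₂ xs ys ls) (hβ : 0 < β) {ε : ℝ} (hε : 0 < ε) :
    δ * β * ((yp - ys) ⬝ᵥ (yp - ys)) + (1 / β) * ((lp - ls) ⬝ᵥ (lp - ls))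
      ≤ δ * β * ((yk - ys) ⬝ᵥ (yk - ys)) + (1 / β) * ((lk - ls) ⬝ᵥ (lk - ls))
        - β * ((yp - yk) ⬝ᵥ
          ((δ • (1 : Matrix (Fin n₂) (Fin n₂) ℝ) - (1 / (2 * ε)) • (Bᵀ * B)) *ᵥ (yp - yk)))
        - ((1 - 2 * ε) / β) * ((lp - lk) ⬝ᵥ (lp - lk)) := by
  have hc := hstep.cross_term_nonneg hsol
  have hl := hstep.2.2.2.2
  set r := A *ᵥ xp + B *ᵥ yp - b
  set d := yp - yk with hd
  have hY := mul_le_mul_of_nonneg_left (two_mul_dotProduct_le r (B *ᵥ d) hε) hβ.le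
  have hD : d ⬝ᵥ ((δ • (1 : Matrix (Fin n₂) (Fin n₂) ℝ) - (1 / (2 * ε)) • (Bᵀ * B)) *ᵥ d) =
      δ * (d ⬝ᵥ d) - 1 / (2 * ε) * ((B *ᵥ d) ⬝ᵥ (B *ᵥ d)) := by
    simp only [sub_mulVec, smul_mulVec, one_mulVec, dotProduct_sub, dotProduct_smul,
      smul_eq_mul, ← mulVec_mulVec, dotProduct_transpose_mulVec_eq]
  have hlk : lk - ls = (lp - ls) + β • r := by rw [hl]; abel
  have hlp : lp - lk = -(β • r) := by rw [hl]; abel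
  have hyk : yk - ys = (yp - ys) - d := by rw [hd]; abel
  rw [hD, hlk, hlp, hyk]
  generalize lp - ls = p at *
  generalize yp - ys = e at *
  simp only [add_dotProduct, dotProduct_add, sub_dotProduct, dotProduct_sub, neg_dotProduct,
    dotProduct_neg, smul_dotProduct, dotProduct_smul, smul_eq_mul, dotProduct_comm p r,
    dotProduct_comm d e]
  have e₁ : 1 / β * (p ⬝ᵥ p + β * (r ⬝ᵥ p) + β * (r ⬝ᵥ p + β * (r ⬝ᵥ r))) =
      1 / β * (p ⬝ᵥ p) + 2 * (r ⬝ᵥ p) + β * (r ⬝ᵥ r) := by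
    field_simp
    ring
  have e₂ : (1 - 2 * ε) / β * -(β * -(β * (r ⬝ᵥ r))) = (1 - 2 * ε) * β * (r ⬝ᵥ r) := by
    field_simp
  rw [e₁, e₂]
  linarith

/-- Theorem 3.2. -/
theorem stmt13 (hm : 0 < m) (hn₁ : 0 < n₁) (hn₂ : 0 < n₂)
    (A : Matrix (Fin m) (Fin n₁) ℝ) (B : Matrix (Fin m) (Fin n₂) ℝ) (b : Fin m → ℝ)
    (X : Set (Fin n₁ → ℝ)) (Y : Set (Fin n₂ → ℝ))
    (hXc : IsClosed X) (hXconv : Convex ℝ X) (hYc : IsClosed Y) (hYconv : Convex ℝ Y)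
    (θ₁ : (Fin n₁ → ℝ) → ℝ) (θ₂ : (Fin n₂ → ℝ) → ℝ)
    (hθ₁ : ConvexOn ℝ Set.univ θ₁) (hθ₂ : ConvexOn ℝ Set.univ θ₂)
    (β δk δk1 : ℝ) (hβ : 0 < β) (hδk : 0 < δk) (hδk1 : 1 ≤ δk1)
    (xs : Fin n₁ → ℝ) (ys : Fin n₂ → ℝ) (ls : Fin m → ℝ)
    (hsol : VISolution A B b X Y θ₁ θ₂ xs ys ls)
    (yk : Fin n₂ → ℝ) (hyk : yk ∈ Y) (lk : Fin m → ℝ)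
    (xp : Fin n₁ → ℝ) (yp : Fin n₂ → ℝ) (lp : Fin m → ℝ)
    (hstep : ADMMStep A B b X Y θ₁ θ₂ β δk yk lk xp yp lp)
    (ε : ℝ) (hε : ε ∈ Set.Ioo (0 : ℝ) (1 / 2))
    (D : Matrix (Fin n₂) (Fin n₂) ℝ)
    (hD : D = δk • (1 : Matrix (Fin n₂) (Fin n₂) ℝ) - (1 / (2 * ε)) • (Bᵀ * B))
    (hDpos : D.PosDef)
    (ξ : ℝ) (hξ : ξ = max 0 (δk - δk1)) :
    δk * β * ((yp - ys) ⬝ᵥ (yp - ys)) + (1 / β) * ((lp - ls) ⬝ᵥ (lp - ls))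
      ≤ (1 + ξ) * (δk1 * β * ((yk - ys) ⬝ᵥ (yk - ys))
          + (1 / β) * ((lk - ls) ⬝ᵥ (lk - ls)))
        - β * ((yp - yk) ⬝ᵥ (D *ᵥ (yp - yk)))
        - ((1 - 2 * ε) / β) * ((lp - lk) ⬝ᵥ (lp - lk)) := by
  have h := hstep.energy_le hsol hβ hε.1
  rw [← hD] at h
  have hξ₀ : 0 ≤ ξ := hξ ▸ le_max_left _ _
  have hξ₁ : δk - δk1 ≤ ξ := hξ ▸ le_max_right _ _
  have hδ : δk ≤ (1 + ξ) * δk1 := by nlinarith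
  have hy : 0 ≤ (yk - ys) ⬝ᵥ (yk - ys) := by simpa using dotProduct_star_self_nonneg (yk - ys)
  have hl : 0 ≤ (lk - ls) ⬝ᵥ (lk - ls) := by simpa using dotProduct_star_self_nonneg (lk - ls)
  have h₁ := mul_le_mul_of_nonneg_right hδ (mul_nonneg hβ.le hy)
  have h₂ : 0 ≤ ξ * (1 / β * ((lk - ls) ⬝ᵥ (lk - ls))) := by positivity
  linarith
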